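/- arXiv:2501.14474 — 3 statements merged into one kernel-verified Lean document; each statement's English description precedes it below -/
import Mathlib

section
/- In the binary outcome model (m = 2 outcomes, rewards r_0 = 0 and r_1 = R for some R > 0), for every contract t ∈ ℝ_{≥0}^2 there exists α ∈ [0,1] such that u_p(θ, α·r) ≥ u_p(θ, t) for every agent type θ. Consequently, for every finitely supported probability distribution D over agent types, OPT(C_linear, D) = OPT(C_unbounded, D); that is, a linear contract is optimal among all unbounded contracts. -/
open scoped BigOperators

/-- An agent type in the hidden-action principal-agent model with `n` actions and
`m` outcomes: a production function `f` (a distribution over outcomes for each action)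
and a nonnegative cost vector `c` with `c 0 = 0`. -/
structure AgentType (n m : ℕ) where
  f : Fin n → Fin m → ℝ
  c : Fin n → ℝ
  f_nonneg : ∀ i j, 0 ≤ f i j
  f_sum : ∀ i, ∑ j, f i j = 1
  c_nonneg : ∀ i, 0 ≤ c i
  c_zero : ∀ i : Fin n, (i : ℕ) = 0 → c i = 0

/-- The agent's expected utility for action `i` under contract `t`. -/
def uA {n m : ℕ} (θ : AgentType n m) (t : Fin m → ℝ) (i : Fin n) : ℝ :=
  (∑ j, θ.f i j * t j) - θ.c i

/-- The principal's expected utility when the agent takes action `i` under contract `t`,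
with rewards `r`. -/
def uPa {n m : ℕ} (r : Fin m → ℝ) (θ : AgentType n m) (t : Fin m → ℝ) (i : Fin n) : ℝ :=
  ∑ j, θ.f i j * (r j - t j)

/-- The set of the agent's best-response actions to contract `t`. -/
def BestResp {n m : ℕ} (θ : AgentType n m) (t : Fin m → ℝ) : Set (Fin n) :=
  {i | ∀ i', uA θ t i' ≤ uA θ t i}

/-- The principal's utility under contract `t`: the agent best-responds, breaking ties
in favor of the principal. -/
noncomputable def uP {n m : ℕ} (r : Fin m → ℝ) (θ : AgentType n m) (t : Fin m → ℝ) : ℝ :=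
  sSup (uPa r θ t '' BestResp θ t)

/-- The class of linear contracts `α • r`, `α ∈ [0,1]`. -/
def Clinear {m : ℕ} (r : Fin m → ℝ) : Set (Fin m → ℝ) :=
  {t | ∃ α : ℝ, α ∈ Set.Icc (0:ℝ) 1 ∧ t = fun j => α * r j}

/-- The class of bounded contracts `[0,1]^m`. -/
def Cbounded (m : ℕ) : Set (Fin m → ℝ) := {t | ∀ j, t j ∈ Set.Icc (0:ℝ) 1}

/-- The class of unbounded contracts `ℝ_{≥0}^m`. -/
def Cunbounded (m : ℕ) : Set (Fin m → ℝ) := {t | ∀ j, 0 ≤ t j}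

/-- A finitely supported probability distribution. -/
structure FinDist (α : Type*) where
  p : α → ℝ
  nonneg : ∀ a, 0 ≤ p a
  finite_support : (Function.support p).Finite
  total : ∑ᶠ a, p a = 1

/-- Expectation of `g` under a finitely supported distribution `D`. -/
noncomputable def expect {α : Type*} (D : FinDist α) (g : α → ℝ) : ℝ :=
  ∑ᶠ a, D.p a * g a

/-- `OPT(C, D)`: the supremum over contracts in `C` of the principal's expected utility. -/
noncomputable def OPT {n m : ℕ} (C : Set (Fin m → ℝ)) (r : Fin m → ℝ)
    (D : FinDist (AgentType n m)) : ℝ :=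
  sSup ((fun t => expect D (fun θ => uP r θ t)) '' C)

/-- Pseudo-dimension shattering: `C` shatters some `k` types in `Θ`. -/
def Shatters {n m : ℕ} (r : Fin m → ℝ) (C : Set (Fin m → ℝ))
    (Θ : Set (AgentType n m)) (k : ℕ) : Prop :=
  ∃ θ : Fin k → AgentType n m, (∀ j, θ j ∈ Θ) ∧ ∃ τ : Fin k → ℝ,
    ∀ S : Finset (Fin k), ∃ t ∈ C,
      (∀ j, j ∈ S → τ j ≤ uP r (θ j) t) ∧ (∀ j, j ∉ S → uP r (θ j) t < τ j)

/-- `Cbar` is an `ε`-approximation of `C` (representation error at most `ε`). -/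
def IsApprox (n : ℕ) {m : ℕ} (r : Fin m → ℝ) (Cbar C : Set (Fin m → ℝ)) (ε : ℝ) : Prop :=
  ∀ D : FinDist (AgentType n m), OPT Cbar r D ≥ OPT C r D - ε

/-- Best responses breaking ties in favor of the principal. -/
def BestRespP {n m : ℕ} (r : Fin m → ℝ) (θ : AgentType n m) (t : Fin m → ℝ) : Set (Fin n) :=
  {i | i ∈ BestResp θ t ∧ ∀ i' ∈ BestResp θ t, uPa r θ t i' ≤ uPa r θ t i}

/-- Principal's expected reward under the linear contract `α • r`. -/
noncomputable def rP {n m : ℕ} (r : Fin m → ℝ) (θ : AgentType n m) (α : ℝ) : ℝ :=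
  sSup ((fun i => ∑ j, θ.f i j * r j) '' BestRespP r θ (fun j => α * r j))

/-- The set of critical values of an agent type for linear contracts. -/
def CritSet {n m : ℕ} (r : Fin m → ℝ) (θ : AgentType n m) : Set ℝ :=
  {α | α ∈ Set.Ioc (0:ℝ) 1 ∧ ∀ ε : ℝ, 0 < ε → ε ≤ α → rP r θ (α - ε) ≠ rP r θ α}

/-- Probability of the event `E` under `N` i.i.d. samples from `D`. -/
noncomputable def prodProb {α : Type*} (D : FinDist α) (N : ℕ) (E : Set (Fin N → α)) : ℝ :=
  ∑ᶠ s ∈ E, ∏ i, D.p (s i)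

/-- The class of `ε`-discrete linear contracts. -/
def Leps {m : ℕ} (r : Fin m → ℝ) (ε : ℝ) : Set (Fin m → ℝ) :=
  {t | ∃ α : ℝ, ((∃ k : ℕ, α = k * ε ∧ k * ε ≤ 1) ∨ α = 1) ∧ t = fun j => α * r j}

theorem bestResp_nonempty {n m : ℕ} (hn : 1 ≤ n) (θ : AgentType n m) (t : Fin m → ℝ) :
    (BestResp θ t).Nonempty :=
  have : Nonempty (Fin n) := ⟨⟨0, hn⟩⟩
  Finite.exists_max (uA θ t)

theorem uPa_le_uP {n m : ℕ} (r : Fin m → ℝ) (θ : AgentType n m) (t : Fin m → ℝ) {i : Fin n}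
    (hi : i ∈ BestResp θ t) : uPa r θ t i ≤ uP r θ t :=
  le_csSup ((Set.toFinite _).bddAbove) (Set.mem_image_of_mem _ hi)

theorem uP_le {n m : ℕ} (hn : 1 ≤ n) {r : Fin m → ℝ} {θ : AgentType n m} {t : Fin m → ℝ} {B : ℝ}
    (h : ∀ i ∈ BestResp θ t, uPa r θ t i ≤ B) : uP r θ t ≤ B :=
  csSup_le ((bestResp_nonempty hn θ t).image _) (Set.forall_mem_image.2 h)

theorem expect_mono {α : Type*} (D : FinDist α) {g h : α → ℝ} (hgh : ∀ a, g a ≤ h a) :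
    expect D g ≤ expect D h :=
  finsum_le_finsum'
    (D.finite_support.subset (Function.support_mul_subset_left _ _))
    (D.finite_support.subset (Function.support_mul_subset_left _ _))
    fun a => mul_le_mul_of_nonneg_left (hgh a) (D.nonneg a)

theorem expect_const {α : Type*} (D : FinDist α) (b : ℝ) : expect D (fun _ => b) = b := by
  rw [expect, ← finsum_mul, D.total, one_mul]

theorem AgentType.f_zero_eq {n : ℕ} (θ : AgentType n 2) (i : Fin n) :
    θ.f i 0 = 1 - θ.f i 1 := by
  have := θ.f_sum i
  rw [Fin.sum_univ_two] at this
  linarith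

theorem AgentType.f_one_le_one {n : ℕ} (θ : AgentType n 2) (i : Fin n) : θ.f i 1 ≤ 1 := by
  linarith [θ.f_zero_eq i, θ.f_nonneg i 0]

theorem uA_binary {n : ℕ} (θ : AgentType n 2) (t : Fin 2 → ℝ) (i : Fin n) :
    uA θ t i = t 0 + θ.f i 1 * (t 1 - t 0) - θ.c i := by
  rw [uA, Fin.sum_univ_two, θ.f_zero_eq]
  ring

theorem uPa_binary {n : ℕ} (r : Fin 2 → ℝ) (hr0 : r 0 = 0) (θ : AgentType n 2) (t : Fin 2 → ℝ)
    (i : Fin n) : uPa r θ t i = θ.f i 1 * (r 1 - (t 1 - t 0)) - t 0 := by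
  rw [uPa, Fin.sum_univ_two, θ.f_zero_eq, hr0]
  ring

/-- In the binary model, every contract is dominated by the linear contract whose parameter is
`(t 1 - t 0) / r 1` clamped to `[0,1]`. -/
theorem exists_linear_dominating {n : ℕ} (hn : 1 ≤ n) {r : Fin 2 → ℝ} (hr0 : r 0 = 0)
    (hr1 : 0 < r 1) {t : Fin 2 → ℝ} (ht : t ∈ Cunbounded 2) :
    ∃ α ∈ Set.Icc (0 : ℝ) 1, ∀ θ : AgentType n 2, uP r θ t ≤ uP r θ (fun j => α * r j) := by
  have ht0 : 0 ≤ t 0 := ht 0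
  have ht1 : 0 ≤ t 1 := ht 1
  rcases lt_or_ge (t 1 - t 0) 0 with hd | hd
  · refine ⟨0, by simp, fun θ => uP_le hn fun i hi => ?_⟩
    have hc := θ.c_zero ⟨0, hn⟩ rfl
    have hmem : (⟨0, hn⟩ : Fin n) ∈ BestResp θ (fun j => 0 * r j) := fun k => by
      simp [uA, hc, θ.c_nonneg k]
    refine le_trans ?_ (uPa_le_uP r θ _ hmem)
    have h0 := hi ⟨0, hn⟩
    rw [uA_binary, uA_binary, hc] at h0
    rw [uPa_binary r hr0, uPa_binary r hr0]
    have hle : θ.f i 1 ≤ θ.f ⟨0, hn⟩ 1 := by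
      by_contra! hlt
      nlinarith [θ.c_nonneg i, mul_pos (sub_pos.2 hlt) (neg_pos.2 hd)]
    nlinarith [mul_le_mul_of_nonneg_right hle hr1.le, mul_nonneg (θ.f_nonneg i 1) ht1,
      mul_nonneg (sub_nonneg.2 (θ.f_one_le_one i)) ht0]
  rcases le_or_gt (t 1 - t 0) (r 1) with hd' | hd'
  · refine ⟨(t 1 - t 0) / r 1, ⟨div_nonneg hd hr1.le, (div_le_one hr1).2 hd'⟩,
      fun θ => uP_le hn fun i hi => ?_⟩
    have hα : (t 1 - t 0) / r 1 * r 1 = t 1 - t 0 := div_mul_cancel₀ _ hr1.ne'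
    have hmem : i ∈ BestResp θ (fun j => (t 1 - t 0) / r 1 * r j) := fun k => by
      have := hi k
      rw [uA_binary, uA_binary] at this ⊢
      simp only [hα, hr0]
      linarith
    refine le_trans ?_ (uPa_le_uP r θ _ hmem)
    rw [uPa_binary r hr0, uPa_binary r hr0]
    simp only [hα, hr0]
    linarith
  · refine ⟨1, by simp, fun θ => uP_le hn fun i _ => ?_⟩
    obtain ⟨k, hk⟩ := bestResp_nonempty hn θ (fun j => 1 * r j)
    refine le_trans ?_ (uPa_le_uP r θ _ hk)
    rw [uPa_binary r hr0, uPa_binary r hr0, hr0]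
    nlinarith [mul_nonneg (θ.f_nonneg i 1) (sub_nonneg.2 hd'.le)]

theorem uP_le_reward {n : ℕ} (hn : 1 ≤ n) {r : Fin 2 → ℝ} (hr0 : r 0 = 0) (hr1 : 0 < r 1)
    {t : Fin 2 → ℝ} (ht : t ∈ Cunbounded 2) (θ : AgentType n 2) : uP r θ t ≤ r 1 :=
  uP_le hn fun i _ => by
    rw [uPa_binary r hr0]
    nlinarith [mul_nonneg (sub_nonneg.2 (θ.f_one_le_one i)) hr1.le,
      mul_nonneg (θ.f_nonneg i 1) (ht 1),
      mul_nonneg (sub_nonneg.2 (θ.f_one_le_one i)) (ht 0)]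

theorem Clinear_subset_Cunbounded {m : ℕ} {r : Fin m → ℝ} (hr : ∀ j, 0 ≤ r j) :
    Clinear r ⊆ Cunbounded m := by
  rintro _ ⟨α, hα, rfl⟩ j
  exact mul_nonneg hα.1 (hr j)

/-- In the binary outcome model (`m = 2`, rewards `r 0 = 0`, `r 1 = R > 0`),
every nonnegative contract is pointwise dominated (over all agent types) by some linear
contract; consequently `OPT(C_linear, D) = OPT(C_unbounded, D)` for every finitely
supported distribution `D` over agent types. -/
theorem stmt_0 (n : ℕ) (hn : 1 ≤ n) (R : ℝ) (hR : 0 < R) (r : Fin 2 → ℝ)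
    (hr0 : r 0 = 0) (hr1 : r 1 = R) :
    (∀ t : Fin 2 → ℝ, t ∈ Cunbounded 2 → ∃ α ∈ Set.Icc (0:ℝ) 1,
        ∀ θ : AgentType n 2, uP r θ t ≤ uP r θ (fun j => α * r j)) ∧
    (∀ D : FinDist (AgentType n 2), OPT (Clinear r) r D = OPT (Cunbounded 2) r D) := by
  subst hr1
  refine ⟨fun t ht => exists_linear_dominating hn hr0 hR ht, fun D => ?_⟩
  have hsub : Clinear r ⊆ Cunbounded 2 :=
    Clinear_subset_Cunbounded (Fin.forall_fin_two.2 ⟨hr0.ge, hR.le⟩)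
  have hlin : (Clinear r).Nonempty := ⟨_, 0, by simp, rfl⟩
  have hbdd : BddAbove ((fun t => expect D (fun θ => uP r θ t)) '' Cunbounded 2) := by
    refine ⟨r 1, Set.forall_mem_image.2 fun t ht => ?_⟩
    exact (expect_mono D (uP_le_reward hn hr0 hR ht)).trans_eq (expect_const D _)
  refine le_antisymm (csSup_le_csSup hbdd (hlin.image _) (Set.image_mono hsub)) ?_
  refine csSup_le ((hlin.mono hsub).image _) (Set.forall_mem_image.2 fun t ht => ?_)
  obtain ⟨α, hα, h⟩ := exists_linear_dominating hn hr0 hR ht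
  exact (expect_mono D h).trans
    (le_csSup (hbdd.mono (Set.image_mono hsub)) (Set.mem_image_of_mem _ ⟨α, hα, rfl⟩))
end

section
/- There is an absolute constant A > 0 such that the following holds for all n, m and all rewards r. If Θ ⊆ Θ_all is a type space and k ≥ 1 is such that every θ ∈ Θ has at most k critical values (|C_θ| ≤ k), then PDim(C_linear, Θ) ≤ A·log₂(k + 2). In particular, since every agent type has at most n − 1 critical values, PDim(C_linear) ≤ A·log₂(n + 1). -/
open scoped BigOperators

/-- The principal's expected reward when the agent takes action `i`. -/
def expReward {n m : ℕ} (r : Fin m → ℝ) (θ : AgentType n m) (i : Fin n) : ℝ :=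
  ∑ j, θ.f i j * r j

section LinearContracts

variable {n m : ℕ} {r : Fin m → ℝ} {θ : AgentType n m}

lemma expReward_nonneg (hr : ∀ j, 0 ≤ r j) (i : Fin n) : 0 ≤ expReward r θ i :=
  Finset.sum_nonneg fun j _ => mul_nonneg (θ.f_nonneg i j) (hr j)

lemma uA_linear (α : ℝ) (i : Fin n) :
    uA θ (fun j => α * r j) i = α * expReward r θ i - θ.c i := by
  simp only [uA, expReward, Finset.mul_sum, mul_left_comm]

lemma uPa_linear (α : ℝ) (i : Fin n) :
    uPa r θ (fun j => α * r j) i = (1 - α) * expReward r θ i := by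
  simp only [uPa, expReward, Finset.mul_sum]
  exact Finset.sum_congr rfl fun j _ => by ring

lemma mem_bestResp_linear {α : ℝ} {i : Fin n} :
    i ∈ BestResp θ (fun j => α * r j) ↔
      ∀ i', α * expReward r θ i' - θ.c i' ≤ α * expReward r θ i - θ.c i := by
  simp only [BestResp, Set.mem_ofPred_eq, uA_linear]

lemma exists_bestResp_max_expReward (hn : 1 ≤ n) (r : Fin m → ℝ) (θ : AgentType n m) (α : ℝ) :
    ∃ i ∈ BestResp θ (fun j => α * r j),
      ∀ i' ∈ BestResp θ (fun j => α * r j), expReward r θ i' ≤ expReward r θ i := by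
  have : Nonempty (Fin n) := ⟨⟨0, hn⟩⟩
  obtain ⟨i₀, hi₀⟩ := Finite.exists_max (uA θ (fun j => α * r j))
  exact Set.exists_max_image _ (expReward r θ) (Set.toFinite _) ⟨i₀, hi₀⟩

/-- Breaking ties in favor of the principal selects a best response of maximal expected
reward. -/
lemma rP_eq_expReward {α : ℝ} (hα : α ≤ 1) {i : Fin n}
    (hi : i ∈ BestResp θ (fun j => α * r j))
    (hmax : ∀ i' ∈ BestResp θ (fun j => α * r j), expReward r θ i' ≤ expReward r θ i) :
    rP r θ α = expReward r θ i := by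
  refine IsGreatest.csSup_eq ⟨⟨i, ⟨hi, fun i' hi' => ?_⟩, rfl⟩, ?_⟩
  · rw [uPa_linear, uPa_linear]
    exact mul_le_mul_of_nonneg_left (hmax i' hi') (by linarith)
  · rintro _ ⟨i', hi', rfl⟩
    exact hmax i' hi'.1

lemma exists_bestResp_expReward_eq_rP (hn : 1 ≤ n) (r : Fin m → ℝ) (θ : AgentType n m) {α : ℝ}
    (hα : α ≤ 1) : ∃ i ∈ BestResp θ (fun j => α * r j), expReward r θ i = rP r θ α := by
  obtain ⟨i, hi, hmax⟩ := exists_bestResp_max_expReward hn r θ α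
  exact ⟨i, hi, (rP_eq_expReward hα hi hmax).symm⟩

lemma expReward_le_rP (hn : 1 ≤ n) {α : ℝ} (hα : α ≤ 1) {i : Fin n}
    (hi : i ∈ BestResp θ (fun j => α * r j)) : expReward r θ i ≤ rP r θ α := by
  obtain ⟨i₀, hi₀, hmax⟩ := exists_bestResp_max_expReward hn r θ α
  exact (hmax i hi).trans_eq (rP_eq_expReward hα hi₀ hmax).symm

lemma rP_nonneg (hn : 1 ≤ n) (hr : ∀ j, 0 ≤ r j) {α : ℝ} (hα : α ≤ 1) : 0 ≤ rP r θ α := by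
  obtain ⟨i, -, hi⟩ := exists_bestResp_expReward_eq_rP hn r θ hα
  exact hi ▸ expReward_nonneg hr i

lemma uP_linear (hn : 1 ≤ n) {α : ℝ} (hα : α ≤ 1) :
    uP r θ (fun j => α * r j) = (1 - α) * rP r θ α := by
  obtain ⟨i, hi, hmax⟩ := exists_bestResp_max_expReward hn r θ α
  rw [rP_eq_expReward hα hi hmax]
  refine IsGreatest.csSup_eq ⟨⟨i, hi, uPa_linear α i⟩, ?_⟩
  rintro _ ⟨i', hi', rfl⟩
  rw [uPa_linear]
  exact mul_le_mul_of_nonneg_left (hmax i' hi') (by linarith)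

lemma rP_mono (hn : 1 ≤ n) {α β : ℝ} (hαβ : α ≤ β) (hβ : β ≤ 1) : rP r θ α ≤ rP r θ β := by
  rcases hαβ.eq_or_lt with rfl | hlt
  · exact le_rfl
  obtain ⟨i, hi, hiα⟩ := exists_bestResp_expReward_eq_rP hn r θ (hαβ.trans hβ)
  obtain ⟨i', hi', hiβ⟩ := exists_bestResp_expReward_eq_rP hn r θ hβ
  rw [← hiα, ← hiβ]
  have h₁ := mem_bestResp_linear.1 hi i'
  have h₂ := mem_bestResp_linear.1 hi' i
  by_contra! h
  nlinarith

lemma isClosed_setOf_mem_bestResp (r : Fin m → ℝ) (θ : AgentType n m) (i : Fin n) :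
    IsClosed {α : ℝ | i ∈ BestResp θ (fun j => α * r j)} := by
  simp only [mem_bestResp_linear, Set.ofPred_forall]
  exact isClosed_iInter fun i' => isClosed_le (by fun_prop) (by fun_prop)

/-- The expected reward is constant between consecutive critical values. -/
lemma rP_eq_of_no_critical (hn : 1 ≤ n) {α β : ℝ} (hα : 0 ≤ α) (hαβ : α ≤ β) (hβ : β ≤ 1)
    (h : ∀ x ∈ CritSet r θ, x ≤ β → x ≤ α) : rP r θ α = rP r θ β := by
  by_contra hne
  have hlt : rP r θ α < rP r θ β := lt_of_le_of_ne (rP_mono hn hαβ hβ) hne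
  let T : Set ℝ := Set.Icc α β ∩
    ⋃ i ∈ {i | rP r θ β ≤ expReward r θ i}, {x | i ∈ BestResp θ (fun j => x * r j)}
  have hT : ∀ x, x ∈ T ↔ x ∈ Set.Icc α β ∧ rP r θ β ≤ rP r θ x := by
    intro x
    simp only [T, Set.mem_inter_iff, Set.mem_iUnion, Set.mem_ofPred_eq, exists_prop]
    refine and_congr_right fun hx => ⟨?_, fun hle => ?_⟩
    · rintro ⟨i, hi, hix⟩
      exact hi.trans (expReward_le_rP hn (hx.2.trans hβ) hix)
    · obtain ⟨i, hi, hix⟩ := exists_bestResp_expReward_eq_rP hn r θ (hx.2.trans hβ)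
      exact ⟨i, hle.trans_eq hix.symm, hi⟩
  have hcomp : IsCompact T := isCompact_Icc.inter_right <|
    (Set.toFinite _).isClosed_biUnion fun i _ => isClosed_setOf_mem_bestResp r θ i
  obtain ⟨s, hsT, hs⟩ := hcomp.exists_isLeast ⟨β, (hT β).2 ⟨⟨hαβ, le_rfl⟩, le_rfl⟩⟩
  obtain ⟨⟨hαs, hsβ⟩, hsr⟩ := (hT s).1 hsT
  have hαs' : α < s := hαs.lt_of_ne fun he => by subst he; linarith
  refine hαs'.not_ge (h s ⟨⟨hα.trans_lt hαs', hsβ.trans hβ⟩, fun ε hε _ heq => ?_⟩ hsβ)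
  rcases le_total α (s - ε) with hle | hle
  · have := hs ((hT (s - ε)).2 ⟨⟨hle, by linarith⟩, heq ▸ hsr⟩)
    linarith
  · have := rP_mono (r := r) (θ := θ) hn hle (hαβ.trans hβ)
    linarith

/-- Distinct critical values have distinct expected rewards, so there are at most `n`. -/
lemma critSet_finite_ncard_le (hn : 1 ≤ n) (r : Fin m → ℝ) (θ : AgentType n m) :
    (CritSet r θ).Finite ∧ (CritSet r θ).ncard ≤ n := by
  have hmaps : Set.MapsTo (rP r θ) (CritSet r θ) (Set.range (expReward r θ)) := fun x hx => by
    obtain ⟨i, -, hi⟩ := exists_bestResp_expReward_eq_rP hn r θ hx.1.2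
    exact ⟨i, hi⟩
  have hne : ∀ x ∈ CritSet r θ, ∀ y ∈ CritSet r θ, x < y → rP r θ x ≠ rP r θ y := by
    intro x hx y hy hxy
    have := hy.2 (y - x) (by linarith) (by linarith [hx.1.1])
    rwa [sub_sub_cancel] at this
  have hinj : Set.InjOn (rP r θ) (CritSet r θ) := by
    intro x hx y hy hxy
    rcases lt_trichotomy x y with h | h | h
    · exact absurd hxy (hne x hx y hy h)
    · exact h
    · exact absurd hxy.symm (hne y hy x hx h)
  refine ⟨Set.Finite.of_injOn hmaps hinj (Set.toFinite _), ?_⟩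
  refine (Set.ncard_le_ncard_of_injOn _ hmaps hinj (Set.toFinite _)).trans ?_
  rw [← Set.image_univ]
  exact (Set.ncard_image_le (Set.toFinite _)).trans (by simp)

/-- If `d` types with at most `k` critical values each are shattered, then the number of subsets
is at most the number of pairs (critical values passed, size of the subset). -/
lemma two_pow_le_of_shatters (hn : 1 ≤ n) (hr : ∀ j, 0 ≤ r j) {Θ : Set (AgentType n m)} {k d : ℕ}
    (hΘ : ∀ θ ∈ Θ, (CritSet r θ).Finite ∧ (CritSet r θ).ncard ≤ k)
    (hsh : Shatters r (Clinear r) Θ d) : 2 ^ d ≤ (d * k + 1) * (d + 1) := by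
  obtain ⟨θ, hθ, τ, H⟩ := hsh
  choose t ht hin hout using H
  choose α hα htα using ht
  let passed (S : Finset (Fin d)) (j : Fin d) : Set ℝ := CritSet r (θ j) ∩ Set.Iic (α S)
  have hfin : ∀ S j, (passed S j).Finite := fun S j =>
    (hΘ _ (hθ j)).1.subset Set.inter_subset_left
  let Φ (S : Finset (Fin d)) : ℕ := ∑ j, (passed S j).ncard
  have hΦ : ∀ S, Φ S ≤ d * k := fun S => by
    refine (Finset.sum_le_card_nsmul _ _ k fun j _ => ?_).trans (by simp)
    exact (Set.ncard_le_ncard Set.inter_subset_left (hΘ _ (hθ j)).1).trans (hΘ _ (hθ j)).2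
  have hsub : ∀ S S', α S ≤ α S' → Φ S = Φ S' → S' ⊆ S := by
    intro S S' hle hΦeq j hj
    have hmono : ∀ j, passed S j ⊆ passed S' j := fun j =>
      Set.inter_subset_inter_right _ (Set.Iic_subset_Iic.2 hle)
    have hcard := (Finset.sum_eq_sum_iff_of_le fun j _ =>
      Set.ncard_le_ncard (hmono j) (hfin S' j)).1 hΦeq j (Finset.mem_univ j)
    have hpass := Set.eq_of_subset_of_ncard_le (hmono j) hcard.ge (hfin S' j)
    have hrP : rP r (θ j) (α S) = rP r (θ j) (α S') :=
      rP_eq_of_no_critical hn (hα S).1 hle (hα S').2 fun x hx hxS' =>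
        (hpass.ge ⟨hx, hxS'⟩ : x ∈ passed S j).2
    by_contra hjS
    have h₁ := hin S' j hj
    have h₂ := hout S j hjS
    rw [htα, uP_linear hn (hα _).2] at h₁ h₂
    have := mul_le_mul_of_nonneg_right (sub_le_sub_left hle 1)
      (rP_nonneg (θ := θ j) hn hr (hα S').2)
    rw [hrP] at h₂
    linarith
  have hinj : Set.InjOn (fun S : Finset (Fin d) => (Φ S, S.card))
      ((Finset.univ : Finset (Finset (Fin d))) : Set (Finset (Fin d))) := by
    intro S _ S' _ hSS'
    obtain ⟨h₁, h₂⟩ := Prod.ext_iff.1 hSS'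
    rcases le_total (α S) (α S') with h | h
    · exact (Finset.eq_of_subset_of_card_le (hsub S S' h h₁) h₂.le).symm
    · exact Finset.eq_of_subset_of_card_le (hsub S' S h h₁.symm) h₂.ge
  have := Finset.card_le_card_of_injOn (s := Finset.univ)
    (t := Finset.range (d * k + 1) ×ˢ Finset.range (d + 1)) _ (fun S _ => by
      have := Finset.card_le_univ S
      rw [Fintype.card_fin] at this
      simp only [Finset.coe_product, Set.mem_prod, Finset.mem_coe, Finset.mem_range]
      exact ⟨Nat.lt_succ_of_le (hΦ S), Nat.lt_succ_of_le this⟩) hinj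
  simpa using this

end LinearContracts

lemma succ_pow_four_le (d : ℕ) : (d + 1) ^ 4 ≤ 64 * 2 ^ d := by
  rcases lt_or_ge d 5 with h | h
  · interval_cases d <;> norm_num
  · induction d, h using Nat.le_induction with
    | base => norm_num
    | succ d hd ih =>
      obtain ⟨e, rfl⟩ := Nat.exists_eq_add_of_le hd
      have : (5 + e + 1 + 1) ^ 4 ≤ 2 * (5 + e + 1) ^ 4 := by
        ring_nf
        nlinarith [Nat.zero_le e, Nat.zero_le (e ^ 2), Nat.zero_le (e ^ 3), Nat.zero_le (e ^ 4)]
      rw [pow_succ 2]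
      linarith

lemma two_pow_le_of_two_pow_le {d k : ℕ} (h : 2 ^ d ≤ (d * k + 1) * (d + 1)) :
    2 ^ d ≤ 64 * (k + 2) ^ 2 := by
  have h₁ : 2 ^ d ≤ (k + 2) * (d + 1) ^ 2 := by nlinarith
  have h₂ : 2 ^ d * 2 ^ d ≤ 2 ^ d * (64 * (k + 2) ^ 2) := calc
    2 ^ d * 2 ^ d ≤ ((k + 2) * (d + 1) ^ 2) * ((k + 2) * (d + 1) ^ 2) := Nat.mul_le_mul h₁ h₁
    _ = (k + 2) ^ 2 * (d + 1) ^ 4 := by ring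
    _ ≤ (k + 2) ^ 2 * (64 * 2 ^ d) := Nat.mul_le_mul_left _ (succ_pow_four_le d)
    _ = 2 ^ d * (64 * (k + 2) ^ 2) := by ring
  exact Nat.le_of_mul_le_mul_left h₂ (by positivity)

lemma le_eight_mul_logb {d k : ℕ} (h : 2 ^ d ≤ 64 * (k + 2) ^ 2) :
    (d : ℝ) ≤ 8 * Real.logb 2 ((k : ℝ) + 2) := by
  have hk : (0 : ℝ) < (k : ℝ) + 2 := by positivity
  have h₁ : (1 : ℝ) ≤ Real.logb 2 ((k : ℝ) + 2) := by
    rw [Real.le_logb_iff_rpow_le one_lt_two hk, Real.rpow_one]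
    linarith [Nat.cast_nonneg (α := ℝ) k]
  have h₂ : (d : ℝ) ≤ Real.logb 2 (2 ^ 6 * ((k : ℝ) + 2) ^ 2) := by
    rw [Real.le_logb_iff_rpow_le one_lt_two (by positivity), Real.rpow_natCast]
    norm_num
    exact_mod_cast h
  rw [Real.logb_mul (by positivity) (by positivity), Real.logb_pow, Real.logb_pow,
    Real.logb_self_eq_one one_lt_two] at h₂
  push_cast at h₂
  linarith

/-- There is an absolute constant `A > 0` such that if every type in `Θ`
has at most `k ≥ 1` critical values, then `PDim(C_linear, Θ) ≤ A·log₂(k+2)`; in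
particular `PDim(C_linear) ≤ A·log₂(n+1)`. -/
theorem stmt_1 : ∃ A : ℝ, 0 < A ∧
    ∀ (n m : ℕ), 1 ≤ n → 2 ≤ m → ∀ r : Fin m → ℝ,
      (∀ j, 0 ≤ r j) → (∀ j : Fin m, (j : ℕ) = 0 → r j = 0) →
      ((∀ (Θ : Set (AgentType n m)) (k : ℕ), 1 ≤ k →
          (∀ θ ∈ Θ, (CritSet r θ).Finite ∧ (CritSet r θ).ncard ≤ k) →
          ∀ d : ℕ, Shatters r (Clinear r) Θ d → (d : ℝ) ≤ A * Real.logb 2 ((k : ℝ) + 2)) ∧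
       (∀ d : ℕ, Shatters r (Clinear r) (Set.univ : Set (AgentType n m)) d →
          (d : ℝ) ≤ A * Real.logb 2 ((n : ℝ) + 1))) := by
  refine ⟨16, by norm_num, fun n m hn _ r hr _ => ?_⟩
  have key : ∀ (Θ : Set (AgentType n m)) (k : ℕ),
      (∀ θ ∈ Θ, (CritSet r θ).Finite ∧ (CritSet r θ).ncard ≤ k) →
      ∀ d : ℕ, Shatters r (Clinear r) Θ d → (d : ℝ) ≤ 8 * Real.logb 2 ((k : ℝ) + 2) :=
    fun Θ k hΘ d hd =>
      le_eight_mul_logb (two_pow_le_of_two_pow_le (two_pow_le_of_shatters hn hr hΘ hd))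
  refine ⟨fun Θ k _ hΘ d hd => ?_, fun d hd => ?_⟩
  · have := key Θ k hΘ d hd
    linarith [Nat.cast_nonneg (α := ℝ) d]
  · have h₁ := key _ n (fun θ _ => critSet_finite_ncard_le hn r θ) d hd
    have hn' : (1 : ℝ) ≤ n := by exact_mod_cast hn
    have h₂ : Real.logb 2 ((n : ℝ) + 2) ≤ Real.logb 2 (((n : ℝ) + 1) ^ 2) :=
      Real.logb_le_logb_of_le one_lt_two (by positivity) (by nlinarith)
    rw [Real.logb_pow] at h₂
    push_cast at h₂
    linarith
end

section
/- There is an absolute constant A > 0 such that for all n ≥ 2, m ≥ 2 and all rewards r, the pseudo-dimension of the class of unbounded contracts satisfies PDim(C_unbounded) ≤ A·m·log₂(m·n); consequently also PDim(C_bounded) ≤ A·m·log₂(m·n). -/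
open scoped BigOperators

open Finset in
theorem sum_choose_le_succ_pow (N d : ℕ) : ∑ i ∈ Iic d, N.choose i ≤ (N + 1) ^ d := by
  induction d with
  | zero => simp [← Nat.range_succ_eq_Iic]
  | succ d ih =>
    rw [← Nat.range_succ_eq_Iic, sum_range_succ, Nat.range_succ_eq_Iic]
    have h₁ : N.choose (d + 1) ≤ N * (N + 1) ^ d := calc
      N.choose (d + 1) ≤ N ^ (d + 1) := Nat.choose_le_pow _ _
      _ = N * N ^ d := by ring
      _ ≤ N * (N + 1) ^ d := by gcongr; omega
    calc _ ≤ (N + 1) ^ d + N * (N + 1) ^ d := add_le_add ih h₁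
      _ = (N + 1) ^ (d + 1) := by ring

/-- Sign patterns of affine functions on `ℝ^m` shatter at most `m + 1` of these functions. -/
theorem card_le_of_shatters_affine {ι : Type*} [DecidableEq ι] {m : ℕ}
    (a : ι → Fin m → ℝ) (b : ι → ℝ) (𝒜 : Finset (Finset ι))
    (h : ∀ s ∈ 𝒜, ∃ t : Fin m → ℝ, ∀ i, i ∈ s ↔ 0 ≤ ∑ j, a i j * t j + b i)
    (s : Finset ι) (hs : 𝒜.Shatters s) : s.card ≤ m + 1 := by
  by_contra! hlt
  let v : s → (Fin m → ℝ) × ℝ := fun i => (a i, b i)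
  have hdep : ¬ LinearIndependent ℝ v := fun hv => by
    have := hv.fintype_card_le_finrank
    simp at this
    omega
  obtain ⟨w, hw, i₀, hi₀⟩ := Fintype.not_linearIndependent_iff.1 hdep
  wlog hneg : w i₀ < 0 generalizing w
  · refine this (-w) (by simpa using hw) (by simpa using hi₀) ?_
    simpa using lt_of_le_of_ne (not_lt.1 hneg) hi₀.symm
  obtain ⟨u, hu, hsu⟩ :=
    hs (t := (Finset.univ.filter fun i : s => 0 ≤ w i).map (Function.Embedding.subtype _))
      (by intro x hx; simp at hx; exact hx.1)
  obtain ⟨t, ht⟩ := h u hu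
  have hmem (i : s) : 0 ≤ w i ↔ 0 ≤ ∑ j, a i j * t j + b i := by
    rw [← ht]
    have := Finset.ext_iff.1 hsu i
    simpa using this.symm
  have h₁ : ∀ j, ∑ i, w i * a i j = 0 := fun j => by
    have := congrFun (congrArg Prod.fst hw) j
    simpa [v, Prod.fst_sum] using this
  have h₂ : ∑ i, w i * b i = 0 := by
    have := congrArg Prod.snd hw
    simpa [v, Prod.snd_sum] using this
  have hzero : ∑ i, w i * (∑ j, a i j * t j + b i) = 0 := by
    simp_rw [mul_add, Finset.sum_add_distrib, h₂, Finset.mul_sum]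
    rw [Finset.sum_comm]
    simp_rw [← mul_assoc, ← Finset.sum_mul, h₁]
    simp
  have hpos : 0 < ∑ i, w i * (∑ j, a i j * t j + b i) := by
    refine Finset.sum_pos' (fun i _ => ?_) ⟨i₀, Finset.mem_univ _, ?_⟩
    · by_cases hi : 0 ≤ w i
      · exact mul_nonneg hi ((hmem i).1 hi)
      · exact mul_nonneg_of_nonpos_of_nonpos (not_le.1 hi).le
          (not_le.1 (mt (hmem i).2 hi)).le
    · exact mul_pos_of_neg_of_neg hneg (not_le.1 (mt (hmem i₀).2 (not_le.2 hneg)))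
  exact hpos.ne' hzero

/-- The number of sign patterns of finitely many affine functions on `ℝ^m`. -/
theorem card_affine_signPatterns_le {ι : Type*} [Fintype ι] [DecidableEq ι] {m : ℕ}
    (a : ι → Fin m → ℝ) (b : ι → ℝ) (𝒜 : Finset (Finset ι))
    (h : ∀ s ∈ 𝒜, ∃ t : Fin m → ℝ, ∀ i, i ∈ s ↔ 0 ≤ ∑ j, a i j * t j + b i) :
    𝒜.card ≤ (Fintype.card ι + 1) ^ (m + 1) := by
  have hvc : 𝒜.vcDim ≤ m + 1 := Finset.sup_le fun s hs =>
    card_le_of_shatters_affine a b 𝒜 h s (Finset.mem_shatterer.1 hs)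
  calc 𝒜.card ≤ 𝒜.shatterer.card := 𝒜.card_le_card_shatterer
    _ ≤ ∑ k ∈ Finset.Iic 𝒜.vcDim, (Fintype.card ι).choose k :=
      Finset.card_shatterer_le_sum_vcDim
    _ ≤ (Fintype.card ι + 1) ^ 𝒜.vcDim := sum_choose_le_succ_pow _ _
    _ ≤ (Fintype.card ι + 1) ^ (m + 1) := Nat.pow_le_pow_right (by omega) hvc

theorem le_uP_iff {n m : ℕ} [NeZero n] (r : Fin m → ℝ) (θ : AgentType n m) (t : Fin m → ℝ)
    (τ : ℝ) : τ ≤ uP r θ t ↔ ∃ i, (∀ i', uA θ t i' ≤ uA θ t i) ∧ τ ≤ uPa r θ t i := by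
  have hfin : (uPa r θ t '' BestResp θ t).Finite := Set.toFinite _
  have hne : (uPa r θ t '' BestResp θ t).Nonempty := by
    obtain ⟨i, hi⟩ := Finite.exists_max (uA θ t)
    exact ⟨_, i, hi, rfl⟩
  constructor
  · intro h
    obtain ⟨i, hi, hiu⟩ := hne.csSup_mem hfin
    exact ⟨i, hi, h.trans_eq hiu.symm⟩
  · rintro ⟨i, hi, hτ⟩
    exact hτ.trans (le_csSup hfin.bddAbove ⟨i, hi, rfl⟩)

theorem Shatters.two_pow_le {n m k : ℕ} [NeZero n] {r : Fin m → ℝ} {C : Set (Fin m → ℝ)}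
    {Θ : Set (AgentType n m)} (h : Shatters r C Θ k) :
    2 ^ k ≤ (k * (n * n + n) + 1) ^ (m + 1) := by
  classical
  obtain ⟨θ, -, τ, hS⟩ := h
  choose t _ htS htS' using hS
  let a : Fin k × (Fin n × Fin n ⊕ Fin n) → Fin m → ℝ := fun p j =>
    Sum.elim (fun q => (θ p.1).f q.1 j - (θ p.1).f q.2 j) (fun i => -(θ p.1).f i j) p.2
  let b : Fin k × (Fin n × Fin n ⊕ Fin n) → ℝ := fun p =>
    Sum.elim (fun q => (θ p.1).c q.2 - (θ p.1).c q.1)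
      (fun i => ∑ j, (θ p.1).f i j * r j - τ p.1) p.2
  let P : Finset (Fin k) → Finset (Fin k × (Fin n × Fin n ⊕ Fin n)) := fun S =>
    Finset.univ.filter fun p => 0 ≤ ∑ j, a p j * t S j + b p
  have hA (S j i i') : (j, Sum.inl (i, i')) ∈ P S ↔ uA (θ j) (t S) i' ≤ uA (θ j) (t S) i := by
    simp only [P, a, b, uA, Finset.mem_filter, Finset.mem_univ, true_and, Sum.elim_inl, sub_mul,
      Finset.sum_sub_distrib]
    constructor <;> intro h <;> linarith
  have hP (S j i) : (j, Sum.inr i) ∈ P S ↔ τ j ≤ uPa r (θ j) (t S) i := by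
    simp only [P, a, b, uPa, Finset.mem_filter, Finset.mem_univ, true_and, Sum.elim_inr, neg_mul,
      mul_sub, Finset.sum_sub_distrib, Finset.sum_neg_distrib]
    constructor <;> intro h <;> linarith
  have hmem (S j) : j ∈ S ↔
      ∃ i, (∀ i', (j, Sum.inl (i, i')) ∈ P S) ∧ (j, Sum.inr i) ∈ P S := by
    simp_rw [hA, hP, ← le_uP_iff]
    exact ⟨htS S j, fun h => by_contra fun hj => (htS' S j hj).not_ge h⟩
  have hinj : Function.Injective P := fun S S' hSS' => by
    ext j
    rw [hmem, hmem, hSS']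
  have := card_affine_signPatterns_le a b (Finset.univ.image P) (by
    intro s hs
    obtain ⟨S, -, rfl⟩ := Finset.mem_image.1 hs
    exact ⟨t S, fun i => by simp [P]⟩)
  rw [Finset.card_image_of_injective _ hinj] at this
  simpa using this

theorem logb_two_le_div_four_add_three {x : ℝ} (hx : 0 < x) : Real.logb 2 x ≤ x / 4 + 3 := by
  have h₂ : 1 / 2 < Real.log 2 := by linarith [Real.log_two_gt_d9]
  have h := Real.log_le_sub_one_of_pos (show 0 < x / 8 by positivity)
  rw [Real.log_div hx.ne' (by norm_num), show (8 : ℝ) = 2 ^ 3 by norm_num, Real.log_pow] at h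
  rw [Real.logb, div_le_iff₀ (by linarith)]
  push_cast at h
  nlinarith [mul_pos hx (sub_pos.2 h₂)]

theorem le_mul_logb_of_two_pow_le {n m k : ℕ} (hn : 2 ≤ n) (hm : 2 ≤ m)
    (h : 2 ^ k ≤ (k * (n * n + n) + 1) ^ (m + 1)) :
    (k : ℝ) ≤ 18 * m * Real.logb 2 ((m : ℝ) * n) := by
  have hn' : (2 : ℝ) ≤ n := by exact_mod_cast hn
  have hm' : (2 : ℝ) ≤ m := by exact_mod_cast hm
  have hlogn : 1 ≤ Real.logb 2 n := by
    rw [Real.le_logb_iff_rpow_le (by norm_num) (by linarith)]; simpa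
  have hlogm : 1 ≤ Real.logb 2 m := by
    rw [Real.le_logb_iff_rpow_le (by norm_num) (by linarith)]; simpa
  rw [Real.logb_mul (by positivity) (by positivity)]
  rcases Nat.eq_zero_or_pos k with rfl | hk
  · simp only [Nat.cast_zero]; positivity
  have hk' : (1 : ℝ) ≤ k := by exact_mod_cast hk
  have hm0 : (0 : ℝ) < m := by linarith
  obtain ⟨x, hx⟩ : ∃ x : ℝ, x = k / m := ⟨_, rfl⟩
  have hx0 : 0 < x := by rw [hx]; positivity
  have hkx : (k : ℝ) = m * x := by rw [hx]; field_simp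
  have hbase : ((k * (n * n + n) + 1 : ℕ) : ℝ) ≤ 2 * (m * x * (n * n)) := by
    rw [← hkx]
    push_cast
    nlinarith [mul_le_mul hk' (show (1 : ℝ) ≤ n * n - n by nlinarith) (by norm_num) (by linarith)]
  have hlog : (k : ℝ) ≤ (m + 1) * Real.logb 2 (2 * (m * x * (n * n))) := by
    have h' : (2 : ℝ) ^ k ≤ (2 * (m * x * (n * n))) ^ (m + 1) :=
      le_trans (by exact_mod_cast h) (pow_le_pow_left₀ (by positivity) hbase _)
    have := Real.logb_le_logb_of_le (b := 2) (by norm_num) (by positivity) h'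
    rwa [Real.logb_pow, Real.logb_pow, Real.logb_self_eq_one (by norm_num), mul_one,
      Nat.cast_add, Nat.cast_one] at this
  rw [Real.logb_mul (by positivity) (by positivity), Real.logb_mul (by positivity) (by positivity),
    Real.logb_mul (by positivity) (by positivity), Real.logb_mul (by positivity) (by positivity),
    Real.logb_self_eq_one (by norm_num)] at hlog
  have hlogx := logb_two_le_div_four_add_three hx0
  set Y := 1 + (Real.logb 2 m + (x / 4 + 3) + (Real.logb 2 n + Real.logb 2 n)) with hY
  have hle : m * x ≤ m * (2 * Y) := by
    calc m * x = k := hkx.symm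
      _ ≤ (m + 1) * Y := hlog.trans (by rw [hY]; gcongr)
      _ ≤ m * (2 * Y) := by
        have : 0 ≤ Y := by positivity
        nlinarith
  have hxY := le_of_mul_le_mul_left hle hm0
  rw [hkx, mul_comm 18, mul_assoc]
  gcongr
  linarith

/-- There is an absolute constant `A > 0` such that for all `n, m ≥ 2` and
all rewards, `PDim(C_unbounded) ≤ A·m·log₂(m·n)`, and consequently also
`PDim(C_bounded) ≤ A·m·log₂(m·n)`. -/
theorem stmt_4 : ∃ A : ℝ, 0 < A ∧
    ∀ (n m : ℕ), 2 ≤ n → 2 ≤ m → ∀ r : Fin m → ℝ,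
      (∀ j, 0 ≤ r j) → (∀ j : Fin m, (j : ℕ) = 0 → r j = 0) →
      (∀ d : ℕ, Shatters r (Cunbounded m) (Set.univ : Set (AgentType n m)) d →
          (d : ℝ) ≤ A * m * Real.logb 2 ((m : ℝ) * n)) ∧
      (∀ d : ℕ, Shatters r (Cbounded m) (Set.univ : Set (AgentType n m)) d →
          (d : ℝ) ≤ A * m * Real.logb 2 ((m : ℝ) * n)) := by
  refine ⟨18, by norm_num, fun n m hn hm r _ _ => ?_⟩
  have : NeZero n := ⟨by omega⟩
  exact ⟨fun d h => le_mul_logb_of_two_pow_le hn hm h.two_pow_le,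
    fun d h => le_mul_logb_of_two_pow_le hn hm h.two_pow_le⟩
end
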